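/- Let α1, α2 ∈ K with 3α1−α2 ≠ 0, and set e3 = (3α1−α2)⁻¹·((a+b)² − (α1+α2)) in D_3(α1,α2) (a central idempotent). Let q be the quadratic form on K² given by q(λ1,λ2) = α1·λ1² + (α2−α1)·λ1·λ2 + α1·λ2². Then the quotient of D_3(α1,α2) by the two-sided ideal generated by 1−e3 is isomorphic as a K-algebra to the Clifford algebra C(K²,q). -/

import Mathlib

noncomputable section

open FreeAlgebra

/-- The defining relations of the PBW deformation `D₃(α₁, α₂)` of the Fomin–Kirillov
algebra `E₃`: with generators `a = ι K 0`, `b = ι K 1`, `c = ι K 2`, the relations are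
`a² = b² = c² = α₁`, `ca + bc + ab = α₂` and `cb + ba + ac = α₂`. -/
inductive D3Rel (K : Type) [Field K] (α1 α2 : K) :
    FreeAlgebra K (Fin 3) → FreeAlgebra K (Fin 3) → Prop
  | ra : D3Rel K α1 α2 (ι K (0 : Fin 3) * ι K (0 : Fin 3))
      (algebraMap K (FreeAlgebra K (Fin 3)) α1)
  | rb : D3Rel K α1 α2 (ι K (1 : Fin 3) * ι K (1 : Fin 3))
      (algebraMap K (FreeAlgebra K (Fin 3)) α1)
  | rc : D3Rel K α1 α2 (ι K (2 : Fin 3) * ι K (2 : Fin 3))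
      (algebraMap K (FreeAlgebra K (Fin 3)) α1)
  | r1 : D3Rel K α1 α2
      (ι K (2 : Fin 3) * ι K (0 : Fin 3) + ι K (1 : Fin 3) * ι K (2 : Fin 3) +
        ι K (0 : Fin 3) * ι K (1 : Fin 3))
      (algebraMap K (FreeAlgebra K (Fin 3)) α2)
  | r2 : D3Rel K α1 α2
      (ι K (2 : Fin 3) * ι K (1 : Fin 3) + ι K (1 : Fin 3) * ι K (0 : Fin 3) +
        ι K (0 : Fin 3) * ι K (2 : Fin 3))
      (algebraMap K (FreeAlgebra K (Fin 3)) α2)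

/-- The algebra `D₃(α₁, α₂)`: the quotient of the free algebra `K⟨a,b,c⟩` by the two-sided
ideal generated by the relations above. -/
abbrev D3 (K : Type) [Field K] (α1 α2 : K) : Type := RingQuot (D3Rel K α1 α2)

/-- The generator `a` of `D₃(α₁, α₂)`. -/
def D3a (K : Type) [Field K] (α1 α2 : K) : D3 K α1 α2 :=
  RingQuot.mkAlgHom K (D3Rel K α1 α2) (ι K (0 : Fin 3))

/-- The generator `b` of `D₃(α₁, α₂)`. -/
def D3b (K : Type) [Field K] (α1 α2 : K) : D3 K α1 α2 :=
  RingQuot.mkAlgHom K (D3Rel K α1 α2) (ι K (1 : Fin 3))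

/-- The generator `c` of `D₃(α₁, α₂)`. -/
def D3c (K : Type) [Field K] (α1 α2 : K) : D3 K α1 α2 :=
  RingQuot.mkAlgHom K (D3Rel K α1 α2) (ι K (2 : Fin 3))

/-- If `a, b, c` satisfy the relations of `D₃(α₁, α₂)` and `(a + b)² = 4α₁`, then `a` and `b`
coincide as soon as `3α₁ ≠ α₂`. -/
theorem D3_eq_of_add_sq {K A : Type*} [Field K] [Semiring A] [Algebra K A] {α1 α2 : K}
    (h : 3 * α1 - α2 ≠ 0) {a b c : A}
    (ha : a * a = algebraMap K A α1) (hb : b * b = algebraMap K A α1)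
    (hc : c * c = algebraMap K A α1)
    (h1 : c * a + b * c + a * b = algebraMap K A α2)
    (h2 : c * b + b * a + a * c = algebraMap K A α2)
    (hsq : (a + b) ^ 2 = algebraMap K A (4 * α1)) : a = b := by
  let _ : Ring A := Algebra.semiringToRing K
  have hu : a * b + b * a = 2 * algebraMap K A α1 := by
    rw [map_mul, map_ofNat] at hsq
    linear_combination (norm := noncomm_ring) hsq - ha - hb
  have hs := Algebra.commutes (A := A) α1
  have ht := Algebra.commutes (A := A) α2
  have key : (3 * algebraMap K A α1 - algebraMap K A α2) * (a - b) = 0 := by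
    generalize algebraMap K A α1 = s at *
    generalize algebraMap K A α2 = t at *
    obtain ⟨x, rfl⟩ : ∃ x, b = a - x := ⟨a - b, by abel⟩
    have hax : x * a = -(a * x) := by
      linear_combination (norm := noncomm_ring) 2 * ha - hu
    have hxx : x * x = 0 := by
      linear_combination (norm := noncomm_ring) hb + ha - hu
    have hcx : c * x = x * c + 2 * (a * x) := by
      linear_combination (norm := noncomm_ring) h1 - h2 - hax
    have hw : c * a + a * c = t - s + x * c + a * x := by
      linear_combination (norm := noncomm_ring) h1 - ha
    have hwx : (c * a + a * c) * x = (t - s) * x := by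
      linear_combination (norm := noncomm_ring)
        hw * x + x * hcx + hxx * c + 2 * hax * x - a * hxx
    have hcomm : c * (x * c + a * x) = (x * c + a * x) * c := by
      linear_combination (norm := noncomm_ring)
        hw * c - c * hw + hc * a - a * hc + hs a + ht c - hs c
    have hcw : (c * a + a * c) * x = 2 * s * x := by
      linear_combination (norm := noncomm_ring)
        hcomm - hcx * c + a * hcx + 2 * ha * x
    linear_combination (norm := noncomm_ring) hwx - hcw
  have hk : (3 * α1 - α2) • (a - b) = 0 := by
    rw [Algebra.smul_def, map_sub, map_mul, map_ofNat, key]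
  exact sub_eq_zero.mp ((smul_eq_zero.mp hk).resolve_left h)

theorem D3_add_swap {K A : Type*} [Field K] [Semiring A] [Algebra K A] {α1 α2 : K} {a c : A}
    (ha : a * a = algebraMap K A α1) (h : c * a + a * c + a * a = algebraMap K A α2) :
    a * c + c * a = algebraMap K A (α2 - α1) := by
  let _ : Ring A := Algebra.semiringToRing K
  rw [map_sub]
  linear_combination (norm := noncomm_ring) h - ha

theorem D3_map_one_sub_smul_add {K A : Type} [Field K] [Semiring A] [Algebra K A] {α1 α2 : K}
    (φ : D3 K α1 α2 →ₐ[K] A) (k s : K) (x : D3 K α1 α2) :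
    φ (1 - k • (x - algebraMap K _ s)) + k • φ x = 1 + k • algebraMap K A s := by
  have aux {B : Type} [Ring B] [Algebra K B] (x y : B) :
      1 - k • (x - y) + k • x = 1 + k • y := by
    rw [smul_sub]
    abel
  have hx : 1 - k • (x - algebraMap K _ s) + k • x = 1 + k • algebraMap K _ s := aux x _
  simpa only [map_add φ, map_smul, map_one, AlgHom.commutes] using congrArg φ hx

theorem D3_e3_Clifford (K : Type) [Field K] [IsAlgClosed K] (hchar : ringChar K ≠ 2)
    (α1 α2 : K) (h : 3 * α1 - α2 ≠ 0)
    (q : QuadraticForm K (Fin 2 → K))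
    (hq : ∀ v : Fin 2 → K,
      q v = α1 * v 0 ^ 2 + (α2 - α1) * (v 0 * v 1) + α1 * v 1 ^ 2) :
    Nonempty
      ((RingQuot (fun x y : D3 K α1 α2 =>
          x = 1 - (3 * α1 - α2)⁻¹ •
            ((D3a K α1 α2 + D3b K α1 α2) ^ 2 - algebraMap K (D3 K α1 α2) (α1 + α2)) ∧
          y = 0)) ≃ₐ[K] CliffordAlgebra q) := by
  let r : D3 K α1 α2 → D3 K α1 α2 → Prop := fun x y =>
    x = 1 - (3 * α1 - α2)⁻¹ •
      ((D3a K α1 α2 + D3b K α1 α2) ^ 2 - algebraMap K (D3 K α1 α2) (α1 + α2)) ∧ y = 0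
  let π : D3 K α1 α2 →ₐ[K] RingQuot r := RingQuot.mkAlgHom K r
  have rel {x y : FreeAlgebra K (Fin 3)} (hxy : D3Rel K α1 α2 x y) :
      π (RingQuot.mkAlgHom K _ x) = π (RingQuot.mkAlgHom K _ y) :=
    congrArg π (RingQuot.mkAlgHom_rel K hxy)
  let a := π (D3a K α1 α2)
  let b := π (D3b K α1 α2)
  let c := π (D3c K α1 α2)
  have ha : a * a = algebraMap K _ α1 := by
    have hr := rel D3Rel.ra
    simp only [map_mul, AlgHom.commutes] at hr
    exact hr
  have hb : b * b = algebraMap K _ α1 := by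
    have hr := rel D3Rel.rb
    simp only [map_mul, AlgHom.commutes] at hr
    exact hr
  have hc : c * c = algebraMap K _ α1 := by
    have hr := rel D3Rel.rc
    simp only [map_mul, AlgHom.commutes] at hr
    exact hr
  have h1 : c * a + b * c + a * b = algebraMap K _ α2 := by
    have hr := rel D3Rel.r1
    simp only [map_mul, map_add, AlgHom.commutes] at hr
    exact hr
  have h2 : c * b + b * a + a * c = algebraMap K _ α2 := by
    have hr := rel D3Rel.r2
    simp only [map_mul, map_add, AlgHom.commutes] at hr
    exact hr
  have hsq : (a + b) ^ 2 = algebraMap K (RingQuot r) (4 * α1) := by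
    have he : π (1 - (3 * α1 - α2)⁻¹ •
        ((D3a K α1 α2 + D3b K α1 α2) ^ 2 - algebraMap K (D3 K α1 α2) (α1 + α2))) = 0 :=
      (RingQuot.mkAlgHom_rel K (s := r) ⟨rfl, rfl⟩).trans (map_zero π)
    have hE := D3_map_one_sub_smul_add π (3 * α1 - α2)⁻¹ (α1 + α2)
      ((D3a K α1 α2 + D3b K α1 α2) ^ 2)
    rw [he, zero_add, inv_smul_eq_iff₀ h, smul_add, smul_inv_smul₀ h,
      ← Algebra.algebraMap_eq_smul_one, ← map_add, map_pow, map_add π] at hE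
    refine hE.trans (congrArg _ ?_)
    ring
  have hab : a = b := D3_eq_of_add_sq h ha hb hc h1 h2 hsq
  have hac : a * c + c * a = algebraMap K _ (α2 - α1) := by
    exact D3_add_swap ha (hab ▸ h1)
  let g : CliffordAlgebra q →ₐ[K] RingQuot r := CliffordAlgebra.lift q
    ⟨(LinearMap.proj 0).smulRight a + (LinearMap.proj 1).smulRight c, fun v => by
      simp only [LinearMap.add_apply, LinearMap.smulRight_apply, LinearMap.proj_apply, hq]
      calc (v 0 • a + v 1 • c) * (v 0 • a + v 1 • c)
          = (v 0 ^ 2) • (a * a) + (v 0 * v 1) • (a * c + c * a) + (v 1 ^ 2) • (c * c) := by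
            simp only [add_mul, mul_add, smul_mul_smul_comm, smul_add, pow_two,
              mul_comm (v 1) (v 0)]
            abel
        _ = _ := by
            rw [ha, hac, hc]
            simp only [Algebra.smul_def, ← map_mul, ← map_add]
            congr 1
            ring⟩
  let X : CliffordAlgebra q := CliffordAlgebra.ι q (Pi.single 0 1)
  let Y : CliffordAlgebra q := CliffordAlgebra.ι q (Pi.single 1 1)
  have hX : X * X = algebraMap K _ α1 := by simp [X, CliffordAlgebra.ι_sq_scalar, hq]
  have hY : Y * Y = algebraMap K _ α1 := by simp [Y, CliffordAlgebra.ι_sq_scalar, hq]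
  have hXY : X * Y + Y * X = algebraMap K _ (α2 - α1) := by
    rw [CliffordAlgebra.ι_mul_ι_add_swap]
    simp [QuadraticMap.polar, hq]
  rw [map_sub] at hXY
  let f₀ : D3 K α1 α2 →ₐ[K] CliffordAlgebra q :=
    RingQuot.liftAlgHom K ⟨FreeAlgebra.lift K ![X, X, Y], by
      intro x y hxy
      cases hxy <;> simp only [map_mul, map_add, AlgHom.commutes, FreeAlgebra.lift_ι_apply,
        Matrix.cons_val]
      · exact hX
      · exact hX
      · exact hY
      · linear_combination (norm := noncomm_ring) hXY + hX
      · linear_combination (norm := noncomm_ring) hXY + hX⟩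
  have f₀_ι (i : Fin 3) :
      f₀ (RingQuot.mkAlgHom K _ (FreeAlgebra.ι K i)) = ![X, X, Y] i := by
    simp [f₀]
  let f : RingQuot r →ₐ[K] CliffordAlgebra q :=
    RingQuot.liftAlgHom K ⟨f₀, by
      rintro x y ⟨rfl, rfl⟩
      have h4 : (X + X) ^ 2 =
          algebraMap K (CliffordAlgebra q) (3 * α1 - α2) + algebraMap K _ (α1 + α2) := by
        simp only [map_add, map_sub, map_mul, map_ofNat]
        linear_combination (norm := noncomm_ring) 4 * hX
      have hE := D3_map_one_sub_smul_add f₀ (3 * α1 - α2)⁻¹ (α1 + α2)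
        ((D3a K α1 α2 + D3b K α1 α2) ^ 2)
      have h0 : f₀ (D3a K α1 α2) = X := f₀_ι 0
      have h1' : f₀ (D3b K α1 α2) = X := f₀_ι 1
      rw [map_pow, map_add f₀, h0, h1', h4, smul_add,
        Algebra.algebraMap_eq_smul_one (3 * α1 - α2), inv_smul_smul₀ h, add_eq_right] at hE
      exact hE.trans (map_zero f₀).symm⟩
  have f_π (x : D3 K α1 α2) : f (π x) = f₀ x := by simp [f, π]
  have g_ι (v : Fin 2 → K) : g (CliffordAlgebra.ι q v) = v 0 • a + v 1 • c := by simp [g]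
  have gX : g X = a := by simp [X, g_ι]
  have gY : g Y = c := by simp [Y, g_ι]
  refine ⟨AlgEquiv.ofAlgHom f g ?_ ?_⟩
  · apply CliffordAlgebra.hom_ext
    refine LinearMap.pi_ext' fun i => LinearMap.ext_ring ?_
    fin_cases i
    · exact (congrArg f gX).trans ((f_π _).trans (f₀_ι 0))
    · exact (congrArg f gY).trans ((f_π _).trans (f₀_ι 2))
  · apply RingQuot.ringQuot_ext'
    apply RingQuot.ringQuot_ext'
    apply FreeAlgebra.hom_ext
    funext i
    have hi : g (f (π (RingQuot.mkAlgHom K _ (FreeAlgebra.ι K i)))) = g (![X, X, Y] i) :=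
      congrArg g ((f_π _).trans (f₀_ι i))
    refine hi.trans ?_
    fin_cases i
    · exact gX
    · exact gX.trans hab
    · exact gY
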